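/- Let 𝓜₁ = {p_μ : μ ∈ M₁} be an m₁-dimensional exponential family in its mean-value parameterization with sufficient statistic φ, M₁ ⊂ ℝ^{m₁} a product of open intervals, and fix an arbitrary CINECSI subset M₁' of M₁. Set μ̂₁'(Xⁿ) = n⁻¹Σ_{i=1}^n φ(X_i). Then there is a constant c > 0 (depending on M₁') such that for all μ ∈ M₁, all n, and all vectors a, a' ∈ ℝ^{m₁} with strictly positive entries for which the ℓ_∞-rectangle R_∞(μ, a, a') = {μ' ∈ ℝ^{m₁} : ∀j, −a'_j ≤ μ'_j − μ_j ≤ a_j} is contained in M₁': P_μ(μ̂₁'(Xⁿ) ∉ R_∞(μ, a, a')) ≤ 2m₁ exp(−n·c·(min_j min{a_j, a'_j})²), where Xⁿ is i.i.d. ∼ p_μ. -/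

import Mathlib

open MeasureTheory ProbabilityTheory Real Set
open scoped ENNReal BigOperators

noncomputable section

namespace SwitchPaper

variable {𝒳 : Type*} [MeasurableSpace 𝒳]

/-- Squared Euclidean distance `‖a − b‖₂²`. -/
def sqDist {m : ℕ} (a b : Fin m → ℝ) : ℝ := ∑ j, (a j - b j) ^ 2

/-- Euclidean inner product. -/
def dot {m : ℕ} (a b : Fin m → ℝ) : ℝ := ∑ j, a j * b j

/-- A CINECSI subset of `M`: a Connected subset of the interior of `M` that is itself
Compact and has NonEmpty interior. -/
def CINECSI {m : ℕ} (M' M : Set (Fin m → ℝ)) : Prop :=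
  IsConnected M' ∧ M' ⊆ interior M ∧ IsCompact M' ∧ (interior M').Nonempty

/-- Hellinger affinity `∫ √(p q) dν = E_{p}[√(q/p)]` between two densities w.r.t. `ν`. -/
def hellingerAffinity (ν : Measure 𝒳) (p q : 𝒳 → ℝ) : ℝ := ∫ x, Real.sqrt (p x * q x) ∂ν

/-- Squared Hellinger distance `d_{H²}(p,q) = 2(1 − E_p[√(q/p)])`. -/
def dH2 (ν : Measure 𝒳) (p q : 𝒳 → ℝ) : ℝ := 2 * (1 - hellingerAffinity ν p q)

/-- Rényi divergence of order 1/2, `d_R(p,q) = −2 log E_p[√(q/p)]`; it is symmetric. -/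
def dRenyiHalf (ν : Measure 𝒳) (p q : 𝒳 → ℝ) : ℝ := -2 * Real.log (hellingerAffinity ν p q)

/-- Kullback–Leibler divergence `D(p‖q) = ∫ p log(p/q) dν` between densities w.r.t. `ν`. -/
def klDiv' (ν : Measure 𝒳) (p q : 𝒳 → ℝ) : ℝ := ∫ x, p x * Real.log (p x / q x) ∂ν

/-- `p : M → 𝒳 → ℝ` is an `m`-dimensional exponential family w.r.t. the base measure `ν`,
given in its mean-value parameterization: the densities have the exponential form
`p_μ(x) = exp(θ(μ)ᵀ φ(x) − ψ(θ(μ))) r(x)`, each `p_μ` is a probability density w.r.t. `ν`,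
the mean of the sufficient statistic `φ` under `p_μ` is `μ`, the parameter set `M` is an
open connected product of open intervals, and the representation is minimal (the components
of `φ`, together with constants, are affinely independent). -/
structure IsMeanValueExpFam {m : ℕ} (ν : Measure 𝒳) (M : Set (Fin m → ℝ))
    (p : (Fin m → ℝ) → 𝒳 → ℝ) (θ : (Fin m → ℝ) → (Fin m → ℝ))
    (φ : 𝒳 → (Fin m → ℝ)) (ψ : (Fin m → ℝ) → ℝ) (carrier : 𝒳 → ℝ) : Prop where
  carrier_pos : ∀ x, 0 < carrier x
  φ_meas : Measurable φ
  p_meas : ∀ μ, Measurable (p μ)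
  M_conn : IsConnected M
  M_prod : ∃ S : Fin m → Set ℝ, (∀ j, IsOpen (S j) ∧ (S j).OrdConnected) ∧ M = Set.univ.pi S
  p_form : ∀ μ ∈ M, ∀ x, p μ x = Real.exp (dot (θ μ) (φ x) - ψ (θ μ)) * carrier x
  p_prob : ∀ μ ∈ M, ∫ x, p μ x ∂ν = 1
  φ_int : ∀ μ ∈ M, Integrable (fun x => (∑ j, |φ x j|) * p μ x) ν
  mean_eq : ∀ μ ∈ M, ∀ i, ∫ x, φ x i * p μ x ∂ν = μ i
  minimal : ∀ c : Fin m → ℝ, ∀ d : ℝ, (∀ x, dot c (φ x) = d) → c = 0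

/-- Covariance matrix of the sufficient statistic `φ` under `p_μ`. -/
def covMatrix {m : ℕ} (ν : Measure 𝒳) (p : (Fin m → ℝ) → 𝒳 → ℝ) (φ : 𝒳 → (Fin m → ℝ))
    (μ : Fin m → ℝ) : Matrix (Fin m) (Fin m) ℝ :=
  Matrix.of fun i j => ∫ x, (φ x i - μ i) * (φ x j - μ j) * p μ x ∂ν

/-- Fisher information matrix in the mean-value parameterization: the inverse of the
covariance matrix of the sufficient statistic. -/
def fisherInfo {m : ℕ} (ν : Measure 𝒳) (p : (Fin m → ℝ) → 𝒳 → ℝ) (φ : 𝒳 → (Fin m → ℝ))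
    (μ : Fin m → ℝ) : Matrix (Fin m) (Fin m) ℝ := (covMatrix ν p φ μ)⁻¹

/-- Quadratic form `vᵀ J v`. -/
def quadForm {m : ℕ} (J : Matrix (Fin m) (Fin m) ℝ) (v : Fin m → ℝ) : ℝ :=
  ∑ i, ∑ j, v i * J i j * v j

/-- Standardized squared error (squared Mahalanobis distance)
`d_ST(a ‖ b) = (b − a)ᵀ I(a) (b − a)`, with `I` the Fisher information. -/
def dST {m : ℕ} (ν : Measure 𝒳) (p : (Fin m → ℝ) → 𝒳 → ℝ) (φ : 𝒳 → (Fin m → ℝ))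
    (a b : Fin m → ℝ) : ℝ := quadForm (fisherInfo ν p φ a) (b - a)

/-- Joint density (likelihood) of an i.i.d. sample. -/
def likelihood {m : ℕ} (p : (Fin m → ℝ) → 𝒳 → ℝ) (μ : Fin m → ℝ) {n : ℕ}
    (xs : Fin n → 𝒳) : ℝ := ∏ i, p μ (xs i)

/-- The law of `n` i.i.d. observations, each with density `f` w.r.t. `ν`. -/
def iidLaw (ν : Measure 𝒳) (f : 𝒳 → ℝ) (n : ℕ) : Measure (Fin n → 𝒳) :=
  (Measure.pi fun _ : Fin n => ν).withDensity fun xs => ENNReal.ofReal (∏ i, f (xs i))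

/-- The (raw) maximum likelihood estimator of an exponential family in its mean-value
parameterization: the empirical mean of the sufficient statistic. -/
def mleRaw {m : ℕ} (φ : 𝒳 → (Fin m → ℝ)) {n : ℕ} (xs : Fin n → 𝒳) : Fin m → ℝ :=
  fun j => (∑ i, φ (xs i) j) / n

/-- Projection `Π₀` onto the simple model: keep the first `m₀` coordinates, replace the
remaining ones by the fixed values. -/
def proj0 {m₁ : ℕ} (m₀ : ℕ) (fixed : Fin m₁ → ℝ) (μ : Fin m₁ → ℝ) : Fin m₁ → ℝ :=
  fun j => if (j : ℕ) < m₀ then μ j else fixed j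

/-- The parameter set of the nested submodel `𝓜₀`: the last `m₁ − m₀` coordinates are
fixed to known values. -/
def nestedSub {m₁ : ℕ} (m₀ : ℕ) (M₁ : Set (Fin m₁ → ℝ)) (fixed : Fin m₁ → ℝ) :
    Set (Fin m₁ → ℝ) := {μ ∈ M₁ | ∀ j : Fin m₁, m₀ ≤ (j : ℕ) → μ j = fixed j}

/-- Embedding of the `m₀`-dimensional parameter of the simple model into `ℝ^{m₁}`. -/
def embed0 {m₀ m₁ : ℕ} (h : m₀ ≤ m₁) (fixed : Fin m₁ → ℝ) (t : Fin m₀ → ℝ) : Fin m₁ → ℝ :=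
  fun j => if hj : (j : ℕ) < m₀ then t ⟨(j : ℕ), hj⟩ else fixed j

/-- Bayes marginal density of a sample: `p_B(xⁿ) = ∫_M w(μ) p_μ(xⁿ) dμ`. -/
def bayesMarginal {m : ℕ} (p : (Fin m → ℝ) → 𝒳 → ℝ) (M : Set (Fin m → ℝ))
    (w : (Fin m → ℝ) → ℝ) {n : ℕ} (xs : Fin n → 𝒳) : ℝ :=
  ∫ μ in M, w μ * likelihood p μ xs

/-- The first `k` observations of a sample of size `n ≥ k`. -/
def prefixObs {n : ℕ} (xs : Fin n → 𝒳) (k : ℕ) (h : k ≤ n) : Fin k → 𝒳 :=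
  fun i => xs (Fin.castLE h i)

/-- The strategy `p̄_t` that switches from the simple to the complex model after `t − 1`
observations: `p̄_t(xⁿ) = p_{B,0}(x^{t−1}) · p_{B,1}(x_t,…,x_n | x^{t−1})`. -/
def pBar (pB0 pB1 : (k : ℕ) → (Fin k → 𝒳) → ℝ) (t : ℕ) {n : ℕ} (xs : Fin n → 𝒳) : ℝ :=
  if h : t - 1 < n then
    pB0 (t - 1) (prefixObs xs (t - 1) h.le) * pB1 n xs / pB1 (t - 1) (prefixObs xs (t - 1) h.le)
  else pB0 n xs

/-- The switch distribution `p_{sw,1}(xⁿ) = Σ_t π(t) p̄_t(xⁿ)`. -/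
def pSwitch (pB0 pB1 : (k : ℕ) → (Fin k → 𝒳) → ℝ) (pri : ℕ → ℝ) {n : ℕ} (xs : Fin n → 𝒳) : ℝ :=
  ∑' t : ℕ, pri t * pBar pB0 pB1 t xs

/-- A prior on switching times supported on powers of two, with `π(2^i) ∝ i^{−κ}`. -/
def SwitchPrior (pri : ℕ → ℝ) (κ : ℝ) : Prop :=
  (∀ t, 0 ≤ pri t) ∧ (∑' t : ℕ, pri t = 1) ∧ (∀ t, pri t ≠ 0 → ∃ i : ℕ, t = 2 ^ i) ∧ 0 < pri 1 ∧
    ∃ c > 0, ∀ i : ℕ, 1 ≤ i → pri (2 ^ i) = c * (i : ℝ) ^ (-κ)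

/-- The event (at sample size `n`) that the switch criterion selects the simple model,
i.e. `p_{sw,1}(xⁿ)/p_{B,0}(xⁿ) ≤ 1`. -/
def swSelectsSimple (pB0 pB1 : (k : ℕ) → (Fin k → 𝒳) → ℝ) (pri : ℕ → ℝ) (n : ℕ) :
    Set (Fin n → 𝒳) := {xs | pSwitch pB0 pB1 pri xs / pB0 n xs ≤ 1}

/-- `small_b(n)`: equal to `1` for `n < b₁` and to `b₂ e^{−b₃ n}` for `n ≥ b₁`. -/
def smallFn (b₁ b₂ b₃ : ℝ) (n : ℕ) : ℝ :=
  if (n : ℝ) < b₁ then 1 else b₂ * Real.exp (-b₃ * n)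

/-- Estimators `μ̆₀, μ̆₁` are sufficiently efficient (with constant `C`, on the set `M₁'`)
w.r.t. the divergence `dgen`: for all `n` and `μ₁ ∈ M₁'`, the risks
`E_{μ₁}[dgen(μ₀, μ̆₀(Xⁿ))]` and `E_{μ₁}[dgen(μ₁, μ̆₁(Xⁿ))]` are bounded by `C/n`,
where `μ₀ = Π₀(μ₁)`. -/
def SuffEff {m₁ : ℕ} (ν : Measure 𝒳) (p : (Fin m₁ → ℝ) → 𝒳 → ℝ) (m₀ : ℕ)
    (fixed : Fin m₁ → ℝ) (M₁' : Set (Fin m₁ → ℝ))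
    (dgen : (Fin m₁ → ℝ) → (Fin m₁ → ℝ) → ℝ)
    (est0 est1 : (n : ℕ) → (Fin n → 𝒳) → (Fin m₁ → ℝ)) (C : ℝ) : Prop :=
  0 < C ∧ ∀ n : ℕ, 0 < n → ∀ μ₁ ∈ M₁',
    (∫ xs, dgen (proj0 m₀ fixed μ₁) (est0 n xs) ∂(iidLaw ν (p μ₁) n)) ≤ C / n ∧
    (∫ xs, dgen μ₁ (est1 n xs) ∂(iidLaw ν (p μ₁) n)) ≤ C / n

end SwitchPaper

namespace SwitchPaper

section Helpers

theorem dot_add_left {m : ℕ} (a b c : Fin m → ℝ) : dot (a + b) c = dot a c + dot b c := by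
  simp [dot, add_mul, Finset.sum_add_distrib]

theorem dot_sub_left {m : ℕ} (a b c : Fin m → ℝ) : dot (a - b) c = dot a c - dot b c := by
  simp [dot, sub_mul, Finset.sum_sub_distrib]

theorem dot_add_right {m : ℕ} (a b c : Fin m → ℝ) : dot a (b + c) = dot a b + dot a c := by
  simp [dot, mul_add, Finset.sum_add_distrib]

theorem dot_sub_right {m : ℕ} (a b c : Fin m → ℝ) : dot a (b - c) = dot a b - dot a c := by
  simp [dot, mul_sub, Finset.sum_sub_distrib]

theorem dot_smul_left {m : ℕ} (t : ℝ) (a b : Fin m → ℝ) : dot (t • a) b = t * dot a b := by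
  simp [dot, Finset.mul_sum, mul_assoc]

theorem dot_smul_right {m : ℕ} (t : ℝ) (a b : Fin m → ℝ) : dot a (t • b) = t * dot a b := by
  simp [dot, Finset.mul_sum]; congr; ext; ring

theorem dot_continuous {m : ℕ} : Continuous (fun z : (Fin m → ℝ) × (Fin m → ℝ) => dot z.1 z.2) := by
  unfold dot; fun_prop

/-- Weak separation of a point from a convex set in finite dimension. -/
theorem exists_support {m : ℕ} (C : Set (Fin m → ℝ)) (hC : Convex ℝ C) (hne : C.Nonempty)
    (x : Fin m → ℝ) (hx : x ∉ interior C) :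
    ∃ u : Fin m → ℝ, u ≠ 0 ∧ ∀ y ∈ C, dot y u ≤ dot x u := by
  suffices h : ∃ f : (Fin m → ℝ) →ₗ[ℝ] ℝ, f ≠ 0 ∧ ∀ y ∈ C, f y ≤ f x by
    obtain ⟨f, hf, hy⟩ := h
    have key : ∀ y, f y = dot y (fun j => f (Pi.single j 1)) := by
      intro y
      conv_lhs => rw [f.pi_apply_eq_sum_univ y]
      simp only [dot, smul_eq_mul]
      refine Finset.sum_congr rfl fun i _ => ?_
      congr 2
      ext j
      simp [Pi.single_apply, eq_comm]
    refine ⟨fun j => f (Pi.single j 1), ?_, fun y hyC => ?_⟩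
    · intro h0
      apply hf
      ext1 y
      ext
      simpa using congrFun h0 y
    · rw [← key, ← key]; exact hy y hyC
  by_cases hi : (interior C).Nonempty
  · obtain ⟨f, hf, h⟩ := geometric_hahn_banach_of_nonempty_interior_point hC hx hi
    refine ⟨f.toLinearMap, ?_, h⟩
    intro h0
    apply hf
    ext y
    exact LinearMap.congr_fun h0 y
  · rw [hC.interior_nonempty_iff_affineSpan_eq_top] at hi
    obtain ⟨z, hz⟩ := hne
    have hz' : z ∈ affineSpan ℝ C := subset_affineSpan ℝ C hz
    have hd : (affineSpan ℝ C).direction < ⊤ := by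
      rw [lt_top_iff_ne_top]
      intro h
      exact hi ((AffineSubspace.direction_eq_top_iff_of_nonempty ⟨z, hz'⟩).1 h)
    obtain ⟨f, hf, hk⟩ := Submodule.exists_le_ker_of_lt_top _ hd
    have hconst : ∀ y ∈ C, f y = f z := by
      intro y hy
      have : y -ᵥ z ∈ (affineSpan ℝ C).direction :=
        AffineSubspace.vsub_mem_direction (subset_affineSpan ℝ C hy) hz'
      have := hk this
      simp [sub_eq_zero] at this
      exact this
    rcases le_total (f z) (f x) with h | h
    · exact ⟨f, hf, fun y hy => by rw [hconst y hy]; exact h⟩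
    · refine ⟨-f, by simpa using hf, fun y hy => ?_⟩
      simp [hconst y hy, h]

theorem exp_le_quad (x : ℝ) : Real.exp x ≤ 1 + x + x ^ 2 * Real.exp |x| := by
  have h := Complex.norm_exp_sub_sum_le_norm_mul_exp (x : ℂ) 2
  simp [Finset.sum_range_succ] at h
  have e : Complex.exp (x : ℂ) - (1 + (x : ℂ)) = ((Real.exp x - (1 + x) : ℝ) : ℂ) := by
    push_cast; rfl
  rw [e, Complex.norm_real, Real.norm_eq_abs] at h
  linarith [le_abs_self (Real.exp x - (1 + x))]

theorem sq_le_exp (τ y : ℝ) (hτ : 0 < τ) : y ^ 2 ≤ 8 / τ ^ 2 * Real.exp (τ / 2 * |y|) := by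
  have h := Real.quadratic_le_exp_of_nonneg (x := τ / 2 * |y|) (by positivity)
  have h2 : (τ / 2 * |y|) ^ 2 / 2 ≤ Real.exp (τ / 2 * |y|) := by
    have : 0 ≤ τ / 2 * |y| := by positivity
    linarith
  rw [mul_pow, sq_abs] at h2
  calc y ^ 2 = 8 / τ ^ 2 * ((τ / 2) ^ 2 * y ^ 2 / 2) := by field_simp; ring
    _ ≤ _ := by gcongr

theorem exp_taylor (τ t y : ℝ) (hτ : 0 < τ) (ht : |t| ≤ τ / 2) :
    Real.exp (t * y) ≤ 1 + t * y + t ^ 2 * (8 / τ ^ 2) * Real.exp (τ * |y|) := by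
  have h1 := exp_le_quad (t * y)
  have h2 := sq_le_exp τ y hτ
  have h3 : Real.exp |t * y| ≤ Real.exp (τ / 2 * |y|) := by
    rw [abs_mul]; gcongr
  have h4 : Real.exp (τ * |y|) = Real.exp (τ / 2 * |y|) * Real.exp (τ / 2 * |y|) := by
    rw [← Real.exp_add]; ring_nf
  have : (t * y) ^ 2 * Real.exp |t * y| ≤ t ^ 2 * (8 / τ ^ 2) * Real.exp (τ * |y|) := by
    rw [h4, mul_pow]
    calc t ^ 2 * y ^ 2 * Real.exp |t * y|
        ≤ t ^ 2 * (8 / τ ^ 2 * Real.exp (τ / 2 * |y|)) * Real.exp (τ / 2 * |y|) := by gcongr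
      _ = _ := by ring
  linarith

/-- Chernoff bound for the law `iidLaw`. -/
theorem chernoff {𝒳 : Type*} [MeasurableSpace 𝒳] (ν : Measure 𝒳) [SigmaFinite ν]
    (f g : 𝒳 → ℝ) (hf0 : ∀ x, 0 ≤ f x)
    (hg : Measurable g) (n : ℕ) (b : ℝ)
    (hint : Integrable (fun x => f x * Real.exp (g x)) ν)
    (hb : ∫ x, f x * Real.exp (g x) ∂ν ≤ Real.exp b) :
    iidLaw ν f n {xs | 0 ≤ ∑ i, g (xs i)} ≤ ENNReal.ofReal (Real.exp (n * b)) := by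
  have hS : MeasurableSet {xs : Fin n → 𝒳 | 0 ≤ ∑ i, g (xs i)} := by
    apply measurableSet_le measurable_const
    exact Finset.measurable_sum _ fun i _ => hg.comp (measurable_pi_apply i)
  unfold iidLaw
  rw [withDensity_apply _ hS]
  have hI : Integrable (fun xs : Fin n → 𝒳 => ∏ i, (f (xs i) * Real.exp (g (xs i))))
      (Measure.pi fun _ : Fin n => ν) :=
    Integrable.fintype_prod (f := fun _ x => f x * Real.exp (g x)) (fun _ => hint)
  calc ∫⁻ xs in {xs : Fin n → 𝒳 | 0 ≤ ∑ i, g (xs i)}, ENNReal.ofReal (∏ i, f (xs i))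
          ∂(Measure.pi fun _ : Fin n => ν)
      ≤ ∫⁻ xs in {xs : Fin n → 𝒳 | 0 ≤ ∑ i, g (xs i)},
          ENNReal.ofReal (∏ i, (f (xs i) * Real.exp (g (xs i))))
          ∂(Measure.pi fun _ : Fin n => ν) := by
        apply setLIntegral_mono' hS
        intro xs hxs
        apply ENNReal.ofReal_le_ofReal
        rw [Finset.prod_mul_distrib, ← Real.exp_sum]
        exact le_mul_of_one_le_right (Finset.prod_nonneg fun i _ => hf0 _) (Real.one_le_exp hxs)
    _ ≤ ∫⁻ xs, ENNReal.ofReal (∏ i, (f (xs i) * Real.exp (g (xs i))))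
          ∂(Measure.pi fun _ : Fin n => ν) := setLIntegral_le_lintegral _ _
    _ = ENNReal.ofReal (∫ xs, (∏ i, (f (xs i) * Real.exp (g (xs i))))
          ∂(Measure.pi fun _ : Fin n => ν)) := by
        rw [ofReal_integral_eq_lintegral_ofReal hI]
        exact Filter.Eventually.of_forall fun xs =>
          Finset.prod_nonneg fun i _ => mul_nonneg (hf0 _) (Real.exp_pos _).le
    _ = ENNReal.ofReal ((∫ x, f x * Real.exp (g x) ∂ν) ^ n) := by
        congr 1
        have := integral_fintype_prod_eq_pow (ι := Fin n) (μ := ν) (fun x => f x * Real.exp (g x))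
        simpa using this
    _ ≤ _ := by
        apply ENNReal.ofReal_le_ofReal
        rw [Real.exp_nat_mul]
        exact pow_le_pow_left₀ (integral_nonneg fun x => mul_nonneg (hf0 _) (Real.exp_pos _).le) hb n

variable {𝒳 : Type*} [MeasurableSpace 𝒳] {m : ℕ} {ν : Measure 𝒳}
    {M : Set (Fin m → ℝ)} {p : (Fin m → ℝ) → 𝒳 → ℝ}
    {θ : (Fin m → ℝ) → (Fin m → ℝ)} {φ : 𝒳 → (Fin m → ℝ)} {ψ : (Fin m → ℝ) → ℝ}
    {r : 𝒳 → ℝ}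

theorem p_pos (hF : IsMeanValueExpFam ν M p θ φ ψ r) {μ} (hμ : μ ∈ M) (x : 𝒳) : 0 < p μ x := by
  rw [hF.p_form μ hμ]; exact mul_pos (Real.exp_pos _) (hF.carrier_pos x)

theorem p_int (hF : IsMeanValueExpFam ν M p θ φ ψ r) {μ} (hμ : μ ∈ M) : Integrable (p μ) ν := by
  by_contra h
  have := hF.p_prob μ hμ
  rw [integral_undef h] at this
  norm_num at this

theorem phi_meas (hF : IsMeanValueExpFam ν M p θ φ ψ r) (j : Fin m) : Measurable fun x => φ x j :=
  (measurable_pi_apply j).comp hF.φ_meas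

theorem dot_meas (hF : IsMeanValueExpFam ν M p θ φ ψ r) (t : Fin m → ℝ) :
    Measurable fun x => dot t (φ x) := by
  unfold dot
  exact Finset.measurable_sum _ fun i _ => (phi_meas hF i).const_mul _

theorem phi_p_int (hF : IsMeanValueExpFam ν M p θ φ ψ r) {μ} (hμ : μ ∈ M) (j : Fin m) :
    Integrable (fun x => φ x j * p μ x) ν := by
  refine (hF.φ_int μ hμ).mono' ((phi_meas hF j).mul (hF.p_meas μ)).aestronglyMeasurable ?_
  refine Filter.Eventually.of_forall fun x => ?_
  rw [norm_mul, Real.norm_eq_abs, Real.norm_eq_abs, abs_of_pos (p_pos hF hμ x)]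
  have := (p_pos hF hμ x).le
  gcongr
  exact Finset.single_le_sum (f := fun j => |φ x j|) (fun i _ => abs_nonneg _) (Finset.mem_univ j)

theorem dot_p_int (hF : IsMeanValueExpFam ν M p θ φ ψ r) {μ} (hμ : μ ∈ M) (t : Fin m → ℝ) :
    Integrable (fun x => dot t (φ x) * p μ x) ν := by
  simp only [dot, Finset.sum_mul, mul_assoc]
  exact integrable_finsetSum _ fun i _ => (phi_p_int hF hμ i).const_mul _

theorem dot_p_integral (hF : IsMeanValueExpFam ν M p θ φ ψ r) {μ} (hμ : μ ∈ M) (t : Fin m → ℝ) :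
    ∫ x, dot t (φ x) * p μ x ∂ν = dot t μ := by
  simp only [dot, Finset.sum_mul, mul_assoc]
  rw [integral_finsetSum _ fun i _ => (phi_p_int hF hμ i).const_mul _]
  refine Finset.sum_congr rfl fun i _ => ?_
  rw [integral_const_mul, hF.mean_eq μ hμ]

/-- Conjugate function. -/
def conj (θ : (Fin m → ℝ) → (Fin m → ℝ)) (ψ : (Fin m → ℝ) → ℝ) (μ : Fin m → ℝ) : ℝ :=
  dot (θ μ) μ - ψ (θ μ)

theorem kl_strict (hF : IsMeanValueExpFam ν M p θ φ ψ r) {μ μ'} (hμ : μ ∈ M) (hμ' : μ' ∈ M)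
    (hne : μ ≠ μ') : conj θ ψ μ + dot (θ μ) (μ' - μ) < conj θ ψ μ' := by
  set L : 𝒳 → ℝ := fun x => dot (θ μ - θ μ') (φ x) + (ψ (θ μ') - ψ (θ μ)) with hL
  have hpL : ∀ x, p μ x = Real.exp (L x) * p μ' x := by
    intro x
    rw [hF.p_form μ hμ, hF.p_form μ' hμ', ← mul_assoc, ← Real.exp_add]
    simp only [hL, dot_sub_left]
    congr 2; ring
  have hLi : Integrable (fun x => L x * p μ' x) ν := by
    simp only [hL, add_mul]
    exact (dot_p_int hF hμ' _).add ((p_int hF hμ').const_mul _)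
  have hLv : ∫ x, L x * p μ' x ∂ν = dot (θ μ - θ μ') μ' + (ψ (θ μ') - ψ (θ μ)) := by
    simp only [hL, add_mul]
    rw [integral_add (dot_p_int hF hμ' _) ((p_int hF hμ').const_mul _), integral_const_mul,
      hF.p_prob μ' hμ', dot_p_integral hF hμ', mul_one]
  have hnn : ∀ x, 0 ≤ p μ x - p μ' x - L x * p μ' x := by
    intro x
    rw [hpL]
    have := Real.add_one_le_exp (L x)
    nlinarith [p_pos hF hμ' x]
  have hval : ∫ x, (p μ x - p μ' x - L x * p μ' x) ∂ν
      = - (dot (θ μ - θ μ') μ' + (ψ (θ μ') - ψ (θ μ))) := by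
    have i0 : Integrable (fun x => p μ x - p μ' x) ν := (p_int hF hμ).sub (p_int hF hμ')
    rw [integral_sub i0 hLi, integral_sub (p_int hF hμ) (p_int hF hμ'), hF.p_prob μ hμ, hF.p_prob μ' hμ', hLv]
    ring
  have hint : Integrable (fun x => p μ x - p μ' x - L x * p μ' x) ν :=
    ((p_int hF hμ).sub (p_int hF hμ')).sub hLi
  have hge : 0 ≤ ∫ x, (p μ x - p μ' x - L x * p μ' x) ∂ν := integral_nonneg hnn
  rcases hge.lt_or_eq with h | h
  · rw [hval] at h
    simp only [conj, dot_sub_right, dot_sub_left] at *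
    linarith
  · exfalso
    have hz := (integral_eq_zero_iff_of_nonneg hnn hint).1 h.symm
    have hpp : ∀ᵐ x ∂ν, p μ x = p μ' x := by
      filter_upwards [hz] with x hx
      simp only [Pi.zero_apply] at hx
      rw [hpL] at hx ⊢
      have hp := p_pos hF hμ' x
      have h0 : L x = 0 := by
        by_contra hne0
        have := Real.add_one_lt_exp hne0
        nlinarith
      simp [h0]
    apply hne
    ext j
    rw [← hF.mean_eq μ hμ, ← hF.mean_eq μ' hμ']
    apply integral_congr_ae
    filter_upwards [hpp] with x hx
    rw [hx]

theorem kl_le (hF : IsMeanValueExpFam ν M p θ φ ψ r) {μ μ'} (hμ : μ ∈ M) (hμ' : μ' ∈ M) :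
    conj θ ψ μ + dot (θ μ) (μ' - μ) ≤ conj θ ψ μ' := by
  by_cases h : μ = μ'
  · subst h; simp [dot]
  · exact (kl_strict hF hμ hμ' h).le

theorem M_open (hF : IsMeanValueExpFam ν M p θ φ ψ r) : IsOpen M := by
  obtain ⟨S, hS, rfl⟩ := hF.M_prod
  exact isOpen_set_pi Set.finite_univ fun j _ => (hS j).1

theorem M_convex (hF : IsMeanValueExpFam ν M p θ φ ψ r) : Convex ℝ M := by
  obtain ⟨S, hS, rfl⟩ := hF.M_prod
  exact convex_pi fun j _ => (hS j).2.convex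

theorem conj_convex (hF : IsMeanValueExpFam ν M p θ φ ψ r) : ConvexOn ℝ M (conj θ ψ) := by
  refine ⟨M_convex hF, ?_⟩
  intro x hx y hy a b ha hb hab
  have hz := M_convex hF hx hy ha hb hab
  have h1 := kl_le hF hz hx
  have h2 := kl_le hF hz hy
  rw [dot_sub_right] at h1 h2
  have e : dot (θ (a • x + b • y)) (a • x + b • y)
      = a * dot (θ (a • x + b • y)) x + b * dot (θ (a • x + b • y)) y := by
    rw [dot_add_right, dot_smul_right, dot_smul_right]
  simp only [smul_eq_mul]
  rw [e] at h1 h2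
  have hb' : b = 1 - a := by linarith
  have h3 := mul_le_mul_of_nonneg_left h1 ha
  have h4 := mul_le_mul_of_nonneg_left h2 hb
  have : conj θ ψ (a • x + b • y) = (a + b) * conj θ ψ (a • x + b • y) := by rw [hab, one_mul]
  rw [this]
  set A := dot (θ (a • x + b • y)) x
  set B := dot (θ (a • x + b • y)) y
  have h5 : a * (A - (a * A + b * B)) + b * (B - (a * A + b * B)) = 0 := by
    rw [hb']; ring
  nlinarith

/-- The natural parameter is bounded on compacts. -/
theorem theta_bdd (hF : IsMeanValueExpFam ν M p θ φ ψ r) (K : Set (Fin m → ℝ))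
    (hK : IsCompact K) (hKM : K ⊆ M) : ∃ R : ℝ, ∀ μ ∈ K, ∀ j, |θ μ j| ≤ R := by
  obtain ⟨δ, hδ, hδM⟩ := hK.exists_cthickening_subset_open (M_open hF) hKM
  have hc : IsCompact (Metric.cthickening δ K) := hK.cthickening
  have hcont : ContinuousOn (conj θ ψ) M := (conj_convex hF).continuousOn (M_open hF)
  obtain ⟨B, hB⟩ := hc.exists_bound_of_continuousOn (hcont.mono hδM)
  refine ⟨2 * B / δ, fun μ hμ j => ?_⟩
  rw [le_div_iff₀ hδ]
  have hb1 := hB μ (Metric.self_subset_cthickening K hμ)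
  have main : ∀ s : ℝ, |s| = δ → s * θ μ j ≤ 2 * B := by
    intro s hs
    have hmem : μ + Pi.single j s ∈ Metric.cthickening δ K := by
      apply Metric.mem_cthickening_of_dist_le _ μ δ K hμ
      rw [dist_eq_norm, add_sub_cancel_left, pi_norm_le_iff_of_nonneg hδ.le]
      intro i
      by_cases h : i = j
      · subst h; simp [hs]
      · simp [Pi.single_apply, h, hδ.le]
    have h1 := kl_le hF (hKM hμ) (hδM hmem)
    have hb2 := hB _ hmem
    have : dot (θ μ) (μ + Pi.single j s - μ) = s * θ μ j := by
      simp [dot, Pi.single_apply, mul_comm]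
    rw [this] at h1
    rw [Real.norm_eq_abs] at hb1 hb2
    have := abs_le.1 hb1
    have := abs_le.1 hb2
    linarith
  rcases le_total 0 (θ μ j) with h | h
  · rw [abs_of_nonneg h]; have := main δ (abs_of_pos hδ); linarith
  · rw [abs_of_nonpos h]; have := main (-δ) (by rw [abs_neg, abs_of_pos hδ]); linarith

/-- The natural parameter space. -/
def natSpace (ν : Measure 𝒳) (φ : 𝒳 → (Fin m → ℝ)) (r : 𝒳 → ℝ) : Set (Fin m → ℝ) :=
  {t | Integrable (fun x => Real.exp (dot t (φ x)) * r x) ν}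

theorem r_meas (hF : IsMeanValueExpFam ν M p θ φ ψ r) : Measurable r := by
  obtain ⟨μ, hμ⟩ := hF.M_conn.nonempty
  have : r = fun x => p μ x * Real.exp (-(dot (θ μ) (φ x) - ψ (θ μ))) := by
    ext x
    rw [hF.p_form μ hμ, mul_right_comm, ← Real.exp_add]
    simp
  rw [this]
  exact (hF.p_meas μ).mul (((dot_meas hF _).sub_const _).neg.exp)

theorem nat_meas (hF : IsMeanValueExpFam ν M p θ φ ψ r) (t : Fin m → ℝ) :
    Measurable (fun x => Real.exp (dot t (φ x)) * r x) :=
  (dot_meas hF t).exp.mul (r_meas hF)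

theorem natSpace_convex (hF : IsMeanValueExpFam ν M p θ φ ψ r) : Convex ℝ (natSpace ν φ r) := by
  intro s hs t ht a b ha hb hab
  have hs' : Integrable _ ν := hs
  have ht' : Integrable _ ν := ht
  refine ((hs'.const_mul a).add (ht'.const_mul b)).mono' (nat_meas hF _).aestronglyMeasurable ?_
  refine Filter.Eventually.of_forall fun x => ?_
  have hr := (hF.carrier_pos x).le
  rw [norm_mul, Real.norm_eq_abs, Real.norm_eq_abs, abs_of_pos (Real.exp_pos _),
    abs_of_pos (hF.carrier_pos x), dot_add_left, dot_smul_left, dot_smul_left]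
  have := convexOn_exp.2 (mem_univ (dot s (φ x))) (mem_univ (dot t (φ x))) ha hb hab
  simp only [smul_eq_mul] at this
  calc _ ≤ (a * Real.exp (dot s (φ x)) + b * Real.exp (dot t (φ x))) * r x := by gcongr
    _ = _ := by simp only [Pi.add_apply]; ring

theorem theta_mem (hF : IsMeanValueExpFam ν M p θ φ ψ r) {μ} (hμ : μ ∈ M) :
    θ μ ∈ natSpace ν φ r := by
  have := (p_int hF hμ).const_mul (Real.exp (ψ (θ μ)))
  refine this.congr (Filter.Eventually.of_forall fun x => ?_)
  simp only []
  rw [hF.p_form μ hμ, ← mul_assoc, ← Real.exp_add]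
  congr 2; ring

theorem closure_interior (hF : IsMeanValueExpFam ν M p θ φ ψ r) (K : Set (Fin m → ℝ))
    (hK : IsCompact K) (hKM : K ⊆ M) {t : Fin m → ℝ} (ht : t ∈ closure (θ '' K)) :
    t ∈ interior (natSpace ν φ r) := by
  obtain ⟨y, hy, hyt⟩ := mem_closure_iff_seq_limit.1 ht
  choose z hzK hz using hy
  obtain ⟨μ, hμK, σ, hσ, hlim⟩ := hK.tendsto_subseq hzK
  have hμ := hKM hμK
  have hθlim : Filter.Tendsto (fun k => θ (z (σ k))) Filter.atTop (nhds t) := by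
    simp only [hz]; exact hyt.comp hσ.tendsto_atTop
  have sub : ∀ μ' ∈ M, conj θ ψ μ + dot t (μ' - μ) ≤ conj θ ψ μ' := by
    intro μ' hμ'
    have h1 : Filter.Tendsto (fun k => conj θ ψ μ + dot (θ μ) (z (σ k) - μ)
        + dot (θ (z (σ k))) (μ' - z (σ k))) Filter.atTop
        (nhds (conj θ ψ μ + dot (θ μ) (μ - μ) + dot t (μ' - μ))) := by
      have hd : ∀ {u v : ℕ → (Fin m → ℝ)} {a b : Fin m → ℝ},
          Filter.Tendsto u Filter.atTop (nhds a) → Filter.Tendsto v Filter.atTop (nhds b) →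
          Filter.Tendsto (fun k => dot (u k) (v k)) Filter.atTop (nhds (dot a b)) := by
        intro u v a b hu hv
        exact (dot_continuous.tendsto (a, b)).comp (hu.prodMk_nhds hv)
      exact (tendsto_const_nhds.add (hd tendsto_const_nhds (hlim.sub_const _))).add
        (hd hθlim (hlim.const_sub _))
    have h2 := le_of_tendsto h1 (b := conj θ ψ μ') (Filter.Eventually.of_forall fun k => by
      have a1 := kl_le hF hμ (hKM (hzK (σ k)))
      have a2 := kl_le hF (hKM (hzK (σ k))) hμ'
      linarith)
    simpa [dot] using h2
  by_contra hcon
  obtain ⟨u, hu, hsup⟩ := exists_support _ (natSpace_convex hF) ⟨_, theta_mem hF hμ⟩ t hcon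
  have hev : ∃ ε : ℝ, 0 < ε ∧ μ + ε • u ∈ M := by
    have hc : Filter.Tendsto (fun ε : ℝ => μ + ε • u) (nhdsWithin 0 (Ioi 0)) (nhds μ) := by
      have : Continuous (fun ε : ℝ => μ + ε • u) := by fun_prop
      have h := this.tendsto 0
      simp only [zero_smul, add_zero] at h
      exact h.mono_left nhdsWithin_le_nhds
    obtain ⟨ε, h1, h2⟩ := ((hc.eventually ((M_open hF).mem_nhds hμ)).and
      self_mem_nhdsWithin).exists
    exact ⟨ε, h2, h1⟩
  obtain ⟨ε, hε, hmem⟩ := hev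
  have hne : μ + ε • u ≠ μ := by
    simp [hε.ne', hu]
  have k1 := kl_strict hF hmem hμ hne
  have k2 := sub _ hmem
  have k3 := hsup _ (theta_mem hF hmem)
  have e1 : μ - (μ + ε • u) = (-ε) • u := by simp
  have e2 : μ + ε • u - μ = ε • u := by simp
  rw [e1, dot_smul_right] at k1
  rw [e2, dot_smul_right] at k2
  nlinarith

/-- Exponential moments near an interior point of the natural parameter space. -/
theorem interior_moment (hF : IsMeanValueExpFam ν M p θ φ ψ r) {t : Fin m → ℝ}
    (ht : t ∈ interior (natSpace ν φ r)) :
    ∃ δ > 0, Integrable (fun x => Real.exp (δ * ∑ j, |φ x j|) *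
      (Real.exp (dot t (φ x)) * r x)) ν := by
  obtain ⟨δ, hδ, hball⟩ := Metric.mem_nhds_iff.1 (mem_interior_iff_mem_nhds.1 ht)
  refine ⟨δ / 2, by positivity, ?_⟩
  set s : (Fin m → Bool) → Fin m → ℝ := fun b j => if b j then δ / 2 else -(δ / 2) with hs
  have hsum : Integrable (fun x => ∑ b : Fin m → Bool, Real.exp (dot (t + s b) (φ x)) * r x) ν := by
    refine integrable_finsetSum _ fun b _ => ?_
    have : t + s b ∈ natSpace ν φ r := by
      apply hball
      rw [Metric.mem_ball, dist_eq_norm, add_sub_cancel_left]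
      refine lt_of_le_of_lt ((pi_norm_le_iff_of_nonneg (r := δ / 2) (by positivity)).2 ?_)
        (by linarith)
      intro j
      simp only [hs]
      split_ifs <;> simp [abs_of_pos hδ]
    exact this
  refine hsum.mono' ?_ (Filter.Eventually.of_forall fun x => ?_)
  · refine Measurable.aestronglyMeasurable (Measurable.mul ?_ (nat_meas hF t))
    refine (Measurable.const_mul ?_ _).exp
    exact Finset.measurable_sum _ fun i _ => (phi_meas hF i).abs
  · have hr := hF.carrier_pos x
    rw [Real.norm_eq_abs, abs_of_pos (by positivity), ← mul_assoc, ← Real.exp_add]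
    have e : δ / 2 * ∑ j, |φ x j| + dot t (φ x)
        = dot (t + s (fun j => decide (0 ≤ φ x j))) (φ x) := by
      rw [dot_add_left, add_comm, Finset.mul_sum]
      congr 1
      refine Finset.sum_congr rfl fun j _ => ?_
      simp only [hs, decide_eq_true_eq]
      split_ifs with h
      · rw [abs_of_nonneg h]
      · rw [abs_of_neg (not_le.1 h)]; ring
    rw [e]
    exact Finset.single_le_sum (f := fun b => Real.exp (dot (t + s b) (φ x)) * r x)
      (fun b _ => by positivity) (Finset.mem_univ _)

/-- Uniform exponential moments on compacts. -/
theorem unif_moment (hF : IsMeanValueExpFam ν M p θ φ ψ r) (K : Set (Fin m → ℝ))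
    (hK : IsCompact K) (hKM : K ⊆ M) :
    ∃ τ > 0, ∃ B : ℝ, ∀ μ ∈ K,
      Integrable (fun x => Real.exp (τ * ∑ j, |φ x j|) * p μ x) ν ∧
      ∫ x, Real.exp (τ * ∑ j, |φ x j|) * p μ x ∂ν ≤ B := by
  obtain ⟨R, hR⟩ := theta_bdd hF K hK hKM
  have hbdd : Bornology.IsBounded (θ '' K) := by
    rw [isBounded_iff_forall_norm_le]
    refine ⟨max R 0, ?_⟩
    rintro _ ⟨μ, hμ, rfl⟩
    rw [pi_norm_le_iff_of_nonneg (le_max_right _ _)]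
    exact fun j => (hR μ hμ j).trans (le_max_left _ _)
  have hT : IsCompact (closure (θ '' K)) := hbdd.isCompact_closure
  obtain ⟨μ₀, hμ₀⟩ := hF.M_conn.nonempty
  -- lower bound on ψ
  obtain ⟨A, hA⟩ : ∃ A, ∀ μ ∈ K, A ≤ ψ (θ μ) := by
    refine ⟨-(∑ j, R * |μ₀ j|) - conj θ ψ μ₀, fun μ hμ => ?_⟩
    have h1 := kl_le hF (hKM hμ) hμ₀
    simp only [conj, dot_sub_right] at h1 ⊢
    have h2 : -(∑ j, R * |μ₀ j|) ≤ dot (θ μ) μ₀ := by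
      rw [dot, ← Finset.sum_neg_distrib]
      refine Finset.sum_le_sum fun j _ => ?_
      have : |θ μ j * μ₀ j| ≤ R * |μ₀ j| := by
        rw [abs_mul]; gcongr; exact hR μ hμ j
      linarith [neg_abs_le (θ μ j * μ₀ j)]
    linarith
  -- local statement and compactness
  have hloc : ∀ t ∈ closure (θ '' K), ∃ δ > 0, Integrable (fun x => Real.exp (δ * ∑ j, |φ x j|) *
      (Real.exp (dot t (φ x)) * r x)) ν := fun t ht =>
    interior_moment hF (closure_interior hF K hK hKM ht)
  choose! δ hδ hδi using hloc
  obtain ⟨F, hFT, hcov⟩ := hT.elim_nhds_subcover (fun t => Metric.ball t (δ t / 2))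
    (fun t ht => Metric.ball_mem_nhds _ (half_pos (hδ t ht)))
  obtain ⟨τ, hτ, hτF⟩ : ∃ τ > 0, ∀ t ∈ F, τ ≤ δ t / 2 := by
    clear hcov
    induction F using Finset.induction_on with
    | empty => exact ⟨1, one_pos, by simp⟩
    | insert a s _ ih =>
      obtain ⟨τ, hτ, h⟩ := ih fun x hx => hFT x (Finset.mem_insert_of_mem hx)
      have ha := half_pos (hδ a (hFT a (Finset.mem_insert_self _ _)))
      refine ⟨min τ (δ a / 2), lt_min hτ ha, ?_⟩
      intro t ht
      rcases Finset.mem_insert.1 ht with rfl | ht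
      · exact min_le_right _ _
      · exact (min_le_left _ _).trans (h t ht)
  set G : (Fin m → ℝ) → 𝒳 → ℝ := fun t x => Real.exp (δ t * ∑ j, |φ x j|) *
      (Real.exp (dot t (φ x)) * r x) with hG
  have hG0 : ∀ t x, 0 ≤ G t x := fun t x => by
    have := hF.carrier_pos x
    simp only [hG]; positivity
  refine ⟨τ, hτ, Real.exp (-A) * ∑ t ∈ F, ∫ x, G t x ∂ν, fun μ hμ => ?_⟩
  obtain ⟨t, htF, htb⟩ : ∃ t ∈ F, θ μ ∈ Metric.ball t (δ t / 2) := by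
    have := hcov (subset_closure (mem_image_of_mem θ hμ))
    simpa using this
  have hle : ∀ x, Real.exp (τ * ∑ j, |φ x j|) * p μ x ≤ Real.exp (-A) * G t x := by
    intro x
    have hr := hF.carrier_pos x
    simp only [hG]
    rw [hF.p_form μ (hKM hμ), ← mul_assoc, ← mul_assoc, ← mul_assoc, ← Real.exp_add,
      ← Real.exp_add, ← Real.exp_add]
    refine mul_le_mul_of_nonneg_right (Real.exp_le_exp.2 ?_) hr.le
    have h1 := hA μ hμ
    have hS : 0 ≤ ∑ j, |φ x j| := Finset.sum_nonneg fun j _ => abs_nonneg _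
    have h2 : τ * ∑ j, |φ x j| ≤ δ t / 2 * ∑ j, |φ x j| :=
      mul_le_mul_of_nonneg_right (hτF t htF) hS
    have h3 : dot (θ μ - t) (φ x) ≤ δ t / 2 * ∑ j, |φ x j| := by
      rw [dot, Finset.mul_sum]
      refine Finset.sum_le_sum fun j _ => ?_
      refine (le_abs_self _).trans ?_
      rw [abs_mul]
      gcongr
      rw [Metric.mem_ball, dist_eq_norm] at htb
      exact (norm_le_pi_norm (θ μ - t) j).trans htb.le
    rw [dot_sub_left] at h3
    linarith
  have hGi : Integrable (G t) ν := hδi t (hFT t htF)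
  have hint : Integrable (fun x => Real.exp (τ * ∑ j, |φ x j|) * p μ x) ν := by
    refine (hGi.const_mul (Real.exp (-A))).mono' ?_ (Filter.Eventually.of_forall fun x => ?_)
    · refine Measurable.aestronglyMeasurable (Measurable.mul ?_ (hF.p_meas μ))
      refine (Measurable.const_mul ?_ _).exp
      exact Finset.measurable_sum _ fun i _ => (phi_meas hF i).abs
    · have := p_pos hF (hKM hμ) x
      rw [Real.norm_eq_abs, abs_of_pos (by positivity)]
      exact hle x
  refine ⟨hint, (integral_mono hint (hGi.const_mul _) hle).trans ?_⟩
  rw [integral_const_mul]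
  gcongr
  exact Finset.single_le_sum (f := fun t => ∫ x, G t x ∂ν)
    (fun t _ => integral_nonneg (hG0 t)) htF

/-- Uniform subgaussian bound for small parameters. -/
theorem unif_mgf (hF : IsMeanValueExpFam ν M p θ φ ψ r) (K : Set (Fin m → ℝ))
    (hK : IsCompact K) (hKM : K ⊆ M) :
    ∃ t₀ > 0, ∃ C > 0, ∀ μ ∈ K, ∀ j, ∀ t : ℝ, |t| ≤ t₀ →
      Integrable (fun x => p μ x * Real.exp (t * (φ x j - μ j))) ν ∧
      ∫ x, p μ x * Real.exp (t * (φ x j - μ j)) ∂ν ≤ Real.exp (C * t ^ 2) := by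
  obtain ⟨τ, hτ, B, hB⟩ := unif_moment hF K hK hKM
  obtain ⟨R, hR⟩ := hK.isBounded.exists_norm_le
  refine ⟨τ / 2, by positivity, 8 / τ ^ 2 * Real.exp (τ * R) * max B 1, by positivity,
    fun μ hμ j t ht => ?_⟩
  obtain ⟨hi, hBi⟩ := hB μ hμ
  have hM := hKM hμ
  set H : 𝒳 → ℝ := fun x => p μ x + t * (φ x j * p μ x - μ j * p μ x)
    + t ^ 2 * (8 / τ ^ 2) * Real.exp (τ * R) * (Real.exp (τ * ∑ j, |φ x j|) * p μ x) with hH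
  have i1 := p_int hF hM
  have i2 : Integrable (fun x => t * (φ x j * p μ x - μ j * p μ x)) ν :=
    ((phi_p_int hF hM j).sub (i1.const_mul (μ j))).const_mul t
  have i3 := hi.const_mul (t ^ 2 * (8 / τ ^ 2) * Real.exp (τ * R))
  have hHi : Integrable H ν := (i1.add i2).add i3
  have hle : ∀ x, p μ x * Real.exp (t * (φ x j - μ j)) ≤ H x := by
    intro x
    have hp := p_pos hF hM x
    have h1 := exp_taylor τ t (φ x j - μ j) hτ ht
    have h2 : Real.exp (τ * |φ x j - μ j|) ≤ Real.exp (τ * R) * Real.exp (τ * ∑ j, |φ x j|) := by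
      rw [← Real.exp_add, ← mul_add]
      gcongr
      have a1 : |φ x j| ≤ ∑ j, |φ x j| :=
        Finset.single_le_sum (f := fun j => |φ x j|) (fun i _ => abs_nonneg _) (Finset.mem_univ j)
      have a2 : |μ j| ≤ R := (norm_le_pi_norm μ j).trans (hR μ hμ)
      have a3 := abs_sub (φ x j) (μ j)
      linarith
    calc p μ x * Real.exp (t * (φ x j - μ j))
        ≤ p μ x * (1 + t * (φ x j - μ j) + t ^ 2 * (8 / τ ^ 2) *
            (Real.exp (τ * R) * Real.exp (τ * ∑ j, |φ x j|))) := by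
          gcongr
          refine h1.trans ?_
          gcongr
      _ = H x := by simp only [hH]; ring
  have hmeas : Measurable (fun x => p μ x * Real.exp (t * (φ x j - μ j))) :=
    (hF.p_meas μ).mul ((((phi_meas hF j).sub_const _).const_mul _).exp)
  have hint : Integrable (fun x => p μ x * Real.exp (t * (φ x j - μ j))) ν := by
    refine hHi.mono' hmeas.aestronglyMeasurable (Filter.Eventually.of_forall fun x => ?_)
    have hp := p_pos hF hM x
    rw [Real.norm_eq_abs, abs_of_pos (by positivity)]
    exact hle x
  refine ⟨hint, (integral_mono hint hHi hle).trans ?_⟩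
  have hval : ∫ x, H x ∂ν = 1 + t ^ 2 * (8 / τ ^ 2) * Real.exp (τ * R) *
      ∫ x, Real.exp (τ * ∑ j, |φ x j|) * p μ x ∂ν := by
    simp only [hH]
    have i0 : Integrable (fun x => p μ x + t * (φ x j * p μ x - μ j * p μ x)) ν := i1.add i2
    rw [integral_add i0 i3, integral_add i1 i2, integral_const_mul, integral_const_mul,
      integral_sub (phi_p_int hF hM j) (i1.const_mul (μ j)), integral_const_mul, hF.p_prob μ hM,
      hF.mean_eq μ hM]
    ring
  rw [hval]
  calc 1 + t ^ 2 * (8 / τ ^ 2) * Real.exp (τ * R) * ∫ x, Real.exp (τ * ∑ j, |φ x j|) * p μ x ∂ν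
      ≤ 1 + t ^ 2 * (8 / τ ^ 2) * Real.exp (τ * R) * max B 1 := by
        gcongr
        exact hBi.trans (le_max_left _ _)
    _ = 8 / τ ^ 2 * Real.exp (τ * R) * max B 1 * t ^ 2 + 1 := by ring
    _ ≤ _ := Real.add_one_le_exp _

end Helpers



/-- Lemma 1, multidimensional large deviation bound: for any CINECSI
subset `M₁'` of `M₁` there is `c > 0` such that for all `μ ∈ M₁`, all `n`, and all positive
vectors `a, a'` whose `ℓ∞`-rectangle around `μ` is contained in `M₁'`,
`P_μ(μ̂₁'(Xⁿ) ∉ R_∞(μ,a,a')) ≤ 2m₁ exp(−n·c·(min_j min{a_j,a'_j})²)`. -/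
theorem statement_11 {𝒳 : Type*} [MeasurableSpace 𝒳] {m₁ : ℕ} (ν : Measure 𝒳) [SigmaFinite ν]
    (M₁ : Set (Fin m₁ → ℝ)) (p : (Fin m₁ → ℝ) → 𝒳 → ℝ)
    (θ : (Fin m₁ → ℝ) → (Fin m₁ → ℝ)) (φ : 𝒳 → (Fin m₁ → ℝ)) (ψ : (Fin m₁ → ℝ) → ℝ)
    (carrier : 𝒳 → ℝ)
    (hF : IsMeanValueExpFam ν M₁ p θ φ ψ carrier)
    (M₁' : Set (Fin m₁ → ℝ)) (hM₁' : CINECSI M₁' M₁) :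
    ∃ c > (0:ℝ), ∀ μ ∈ M₁, ∀ n : ℕ, ∀ a a' : Fin m₁ → ℝ,
      (∀ j, 0 < a j) → (∀ j, 0 < a' j) →
      {μ' : Fin m₁ → ℝ | ∀ j, -(a' j) ≤ μ' j - μ j ∧ μ' j - μ j ≤ a j} ⊆ M₁' →
      (iidLaw ν (p μ) n)
          {xs | mleRaw φ xs ∉
            {μ' : Fin m₁ → ℝ | ∀ j, -(a' j) ≤ μ' j - μ j ∧ μ' j - μ j ≤ a j}}
        ≤ ENNReal.ofReal
            (2 * m₁ * Real.exp (-(n : ℝ) * c * (⨅ j, min (a j) (a' j)) ^ 2)) := by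
  obtain ⟨-, hsub, hcomp, -⟩ := hM₁'
  have hKM : M₁' ⊆ M₁ := hsub.trans interior_subset
  obtain ⟨t₀, ht₀, C, hC, hmgf⟩ := unif_mgf hF M₁' hcomp hKM
  obtain ⟨R, hR⟩ := hcomp.isBounded.exists_norm_le
  have hD : 0 < 2 * |R| + 1 := by positivity
  set ε : ℝ := min (t₀ / (2 * |R| + 1)) (1 / (2 * C)) with hε
  have hε0 : 0 < ε := lt_min (by positivity) (by positivity)
  refine ⟨ε / 2, by positivity, ?_⟩
  intro μ hμ n a a' ha ha' hrect
  rcases Nat.eq_zero_or_pos m₁ with h0 | hm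
  · subst h0
    simp
  have hne : Nonempty (Fin m₁) := ⟨⟨0, hm⟩⟩
  set A : ℝ := ⨅ j, min (a j) (a' j) with hA
  have hAle : ∀ j, A ≤ min (a j) (a' j) := fun j => ciInf_le (Set.finite_range _).bddBelow j
  have hA0 : 0 ≤ A := le_ciInf fun j => (lt_min (ha j) (ha' j)).le
  have hμK : μ ∈ M₁' := hrect (fun j => by simp [(ha j).le, (ha' j).le])
  have hAD : A ≤ 2 * |R| + 1 := by
    let j : Fin m₁ := ⟨0, hm⟩
    have hmem : μ + Pi.single j (a j) ∈ M₁' := by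
      apply hrect
      intro i
      have h1 := ha i
      have h2 := ha' i
      by_cases h : i = j
      · subst h
        simp only [Pi.add_apply, Pi.single_eq_same]
        constructor <;> linarith
      · simp only [Pi.add_apply, Pi.single_apply, h, if_false]
        constructor <;> linarith
    have h1 := (norm_le_pi_norm _ j).trans (hR _ hmem)
    have h2 := (norm_le_pi_norm _ j).trans (hR _ hμK)
    simp only [Pi.add_apply, Pi.single_eq_same, Real.norm_eq_abs] at h1 h2
    have h3 := (hAle j).trans (min_le_left _ _)
    have h4 := abs_le.1 h1
    have h5 := abs_le.1 h2
    have h6 := le_abs_self R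
    linarith
  have hεC : C * ε ≤ 1 / 2 := by
    have h : ε ≤ 1 / (2 * C) := min_le_right _ _
    calc C * ε ≤ C * (1 / (2 * C)) := by gcongr
      _ = 1 / 2 := by field_simp
  have hεt : ε * A ≤ t₀ := by
    have h : ε ≤ t₀ / (2 * |R| + 1) := min_le_left _ _
    calc ε * A ≤ t₀ / (2 * |R| + 1) * (2 * |R| + 1) := by gcongr
      _ = t₀ := by field_simp
  let sg : Bool → ℝ := fun b => if b then 1 else -1
  let g : Fin m₁ × Bool → 𝒳 → ℝ := fun z x => sg z.2 * (ε * A) * (φ x z.1 - μ z.1) - ε * A * A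
  have hbound : ∀ z, iidLaw ν (p μ) n {xs | 0 ≤ ∑ i, g z (xs i)}
      ≤ ENNReal.ofReal (Real.exp (-(n : ℝ) * (ε / 2) * A ^ 2)) := by
    intro z
    have hs2 : sg z.2 ^ 2 = 1 := by
      simp only [sg]; split_ifs <;> norm_num
    have hsa : |sg z.2| = 1 := by
      simp only [sg]; split_ifs <;> norm_num
    have habs : |sg z.2 * (ε * A)| ≤ t₀ := by
      rw [abs_mul, hsa, one_mul, abs_of_nonneg (by positivity)]; exact hεt
    obtain ⟨hi, hv⟩ := hmgf μ hμK z.1 (sg z.2 * (ε * A)) habs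
    have heq : ∀ x, p μ x * Real.exp (g z x) = Real.exp (-(ε * A * A)) *
        (p μ x * Real.exp (sg z.2 * (ε * A) * (φ x z.1 - μ z.1))) := by
      intro x
      simp only [g]
      rw [sub_eq_add_neg, Real.exp_add]; ring
    have hch := chernoff ν (p μ) (g z) (fun x => (p_pos hF hμ x).le)
      ((((phi_meas hF z.1).sub_const _).const_mul _).sub_const _) n (-(ε / 2 * A ^ 2))
      (by simp only [heq]; exact hi.const_mul _)
      (by
        simp only [heq]
        rw [integral_const_mul]
        calc _ ≤ Real.exp (-(ε * A * A)) * Real.exp (C * (sg z.2 * (ε * A)) ^ 2) := by gcongr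
          _ = Real.exp (-(ε * A * A) + C * (sg z.2 * (ε * A)) ^ 2) := by rw [Real.exp_add]
          _ ≤ _ := by
            apply Real.exp_le_exp.2
            rw [mul_pow, hs2, one_mul]
            have : C * (ε * A) ^ 2 = (C * ε) * (ε * A ^ 2) := by ring
            rw [this]
            have h2 : (C * ε) * (ε * A ^ 2) ≤ 1 / 2 * (ε * A ^ 2) := by gcongr
            linarith)
    refine hch.trans (le_of_eq ?_)
    congr 2; ring
  have hincl : {xs : Fin n → 𝒳 | mleRaw φ xs ∉
      {μ' : Fin m₁ → ℝ | ∀ j, -(a' j) ≤ μ' j - μ j ∧ μ' j - μ j ≤ a j}}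
      ⊆ ⋃ z, {xs : Fin n → 𝒳 | 0 ≤ ∑ i, g z (xs i)} := by
    intro xs hxs
    simp only [Set.mem_setOf_eq, not_forall] at hxs
    obtain ⟨j, hj⟩ := hxs
    rw [Set.mem_iUnion]
    have hsum : ∀ b, ∑ i, g (j, b) (xs i)
        = (ε * A) * (sg b * ((∑ i, φ (xs i) j) - n * μ j) - n * A) := by
      intro b
      simp only [g, Finset.sum_sub_distrib, ← Finset.mul_sum, Finset.sum_const, Finset.card_univ,
        Fintype.card_fin, nsmul_eq_mul]
      ring
    rcases Nat.eq_zero_or_pos n with hn | hn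
    · subst hn
      exact ⟨(j, true), by simp⟩
    have hn' : (0 : ℝ) < n := by exact_mod_cast hn
    have hεA : 0 ≤ ε * A := by positivity
    have hm1 : mleRaw φ xs j * n = ∑ i, φ (xs i) j := by
      simp only [mleRaw]; field_simp
    have hl1 := (hAle j).trans (min_le_left _ _)
    have hl2 := (hAle j).trans (min_le_right _ _)
    by_cases hup : mleRaw φ xs j - μ j ≤ a j
    · have hlow : mleRaw φ xs j - μ j < -(a' j) := by
        by_contra h
        exact hj ⟨not_lt.1 h, hup⟩
      refine ⟨(j, false), ?_⟩
      simp only [Set.mem_setOf_eq]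
      rw [hsum, ← hm1]
      refine mul_nonneg hεA ?_
      simp only [sg, Bool.false_eq_true, if_false]
      have : 0 ≤ n * (-(mleRaw φ xs j - μ j) - A) := mul_nonneg hn'.le (by linarith)
      linarith
    · refine ⟨(j, true), ?_⟩
      simp only [Set.mem_setOf_eq]
      rw [hsum, ← hm1]
      refine mul_nonneg hεA ?_
      simp only [sg, if_true]
      have : 0 ≤ n * ((mleRaw φ xs j - μ j) - A) := mul_nonneg hn'.le (by linarith [not_le.1 hup])
      linarith
  calc _ ≤ iidLaw ν (p μ) n (⋃ z, {xs : Fin n → 𝒳 | 0 ≤ ∑ i, g z (xs i)}) := measure_mono hincl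
    _ ≤ ∑ z, iidLaw ν (p μ) n {xs : Fin n → 𝒳 | 0 ≤ ∑ i, g z (xs i)} :=
        measure_iUnion_fintype_le _ _
    _ ≤ ∑ _z : Fin m₁ × Bool, ENNReal.ofReal (Real.exp (-(n : ℝ) * (ε / 2) * A ^ 2)) :=
        Finset.sum_le_sum fun z _ => hbound z
    _ = _ := by
        rw [← ENNReal.ofReal_sum_of_nonneg fun _ _ => (Real.exp_pos _).le]
        congr 1
        simp
        ring

end SwitchPaper
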